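/- arXiv:0909.1623 — 10 statements merged into one kernel-verified Lean document; each statement's English description precedes it below -/
import Mathlib

section
/- Quasi-periodicity of the DTLCT: for every finitely supported sequence x : ℤ → ℂ with sampling period T and every ω ∈ ℝ, X(ω + 2π) = exp( i·(2π·d·b/T²)·(ω + π) ) · X(ω). -/
open Real Complex

/-- Discrete-time linear canonical transform (constant prefactor omitted). -/
noncomputable def dtlct (a b d T : ℝ) (x : ℤ → ℂ) (ω : ℝ) : ℂ :=
  ∑ᶠ n : ℤ, x n * Complex.exp ((Complex.I / 2) *
    (((a / b) * (n : ℝ) ^ 2 * T ^ 2 - 2 * (n : ℝ) * ω + (d * b / T ^ 2) * ω ^ 2 : ℝ) : ℂ))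

/-- Quasi-periodicity of the DTLCT:
`X(ω + 2π) = exp(i·(2π·d·b/T²)·(ω + π)) · X(ω)`. -/
theorem dtlct_quasi_periodic
    (a b c d T : ℝ) (hb : 0 < b) (habcd : a * d - b * c = 1) (hT : 0 < T)
    (x : ℤ → ℂ) (hx : (Function.support x).Finite) :
    ∀ ω : ℝ,
      dtlct a b d T x (ω + 2 * π) =
        Complex.exp (Complex.I * (((2 * π * d * b / T ^ 2) * (ω + π) : ℝ) : ℂ)) *
          dtlct a b d T x ω := by
  intro ω
  unfold dtlct
  rw [mul_finsum]
  refine finsum_congr fun n => ?_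
  rw [mul_left_comm, ← Complex.exp_add]
  congr 1
  refine Complex.exp_eq_exp_iff_exists_int.mpr ⟨-n, ?_⟩
  push_cast
  ring
end

section
/- Upsampling theorem for the DTLCT: let x : ℤ → ℂ be finitely supported with sampling period T, let L be a positive integer, and define y(L·n) = x(n) and y(m) = 0 whenever L does not divide m; y has sampling period T/L. Then the DTLCT Y of y (taken with sampling period T/L) satisfies Y(ω) = X(L·ω) for all ω ∈ ℝ, where X is the DTLCT of x with sampling period T. -/
open Real Complex

/-- A finite sum over a function supported in the range of an injective map can be reindexed
along that map. -/
theorem finsum_comp_of_support_subset_range {α β M : Type*} [AddCommMonoid M] {g : α → β}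
    (hg : Function.Injective g) {f : β → M} (hf : Function.support f ⊆ Set.range g) :
    ∑ᶠ j, f j = ∑ᶠ i, f (g i) := by
  rw [← finsum_mem_range hg, ← finsum_mem_univ f]
  exact finsum_mem_inter_support_eq' _ _ _ fun j hj => by simpa using hf hj

/-- Upsampling theorem for the DTLCT: if `y` is the upsampling of `x` by `L`
(sampling period `T/L`), then `Y(ω) = X(L·ω)`. -/
theorem dtlct_upsample
    (a b c d T : ℝ) (hb : 0 < b) (habcd : a * d - b * c = 1) (hT : 0 < T)
    (x : ℤ → ℂ) (hx : (Function.support x).Finite)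
    (L : ℤ) (hL : 0 < L)
    (y : ℤ → ℂ)
    (hy₁ : ∀ n : ℤ, y (L * n) = x n)
    (hy₂ : ∀ m : ℤ, ¬ (L ∣ m) → y m = 0) :
    ∀ ω : ℝ, dtlct a b d (T / (L : ℝ)) y ω = dtlct a b d T x ((L : ℝ) * ω) := by
  intro ω
  have hLz : L ≠ 0 := hL.ne'
  have hLr : (L : ℝ) ≠ 0 := Int.cast_ne_zero.mpr hLz
  unfold dtlct
  rw [finsum_comp_of_support_subset_range (mul_right_injective₀ hLz)]
  · refine finsum_congr fun n => ?_
    rw [hy₁]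
    congr 4
    push_cast
    field_simp
  · intro m hm
    by_contra hrange
    refine hm ?_
    have hdvd : ¬ L ∣ m := fun ⟨k, hk⟩ => hrange ⟨k, hk.symm⟩
    simp [hy₂ m hdvd]
end

section
/- Downsampling-by-2 theorem for the DTLCT: let x : ℤ → ℂ be finitely supported with sampling period T and define y(n) = x(2n), which has sampling period 2T. Then the DTLCT Y of y (taken with sampling period 2T) satisfies Y(ω) = (1/2)·[ X(ω/2) + exp( −i·(π·d·b/(2T²))·(ω + π) )·X(ω/2 + π) ] for all ω ∈ ℝ, where X is the DTLCT of x with sampling period T. -/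
open Real Complex

/-- A sum over `ℤ` of a function vanishing at odd integers is the sum over
even integers. -/
theorem finsum_int_eq_finsum_two_mul {M : Type*} [AddCommMonoid M] (f : ℤ → M)
    (hf : ∀ n, f (2 * n + 1) = 0) : ∑ᶠ n, f n = ∑ᶠ n, f (2 * n) := by
  have hinj : Function.Injective fun n : ℤ => 2 * n := fun m n h => by
    simpa using h
  rw [← finsum_mem_range (f := f) hinj]
  refine finsum_congr fun n => ?_
  obtain ⟨k, rfl | rfl⟩ := Int.even_or_odd' n
  · simp
  · simp [hf]

/-- The kernel against which `dtlct` sums a sequence. -/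
noncomputable def dtlctKernel (a b d T : ℝ) (n : ℤ) (ω : ℝ) : ℂ :=
  Complex.exp ((Complex.I / 2) *
    (((a / b) * (n : ℝ) ^ 2 * T ^ 2 - 2 * (n : ℝ) * ω + (d * b / T ^ 2) * ω ^ 2 : ℝ) : ℂ))

theorem dtlctKernel_two_mul (a b d T : ℝ) (n : ℤ) (ω : ℝ) :
    dtlctKernel a b d T (2 * n) (ω / 2) = dtlctKernel a b d (2 * T) n ω := by
  unfold dtlctKernel
  congr 3
  push_cast
  ring

theorem exp_mul_dtlctKernel_add_pi (a b d T : ℝ) (n : ℤ) (ω : ℝ) :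
    Complex.exp (-Complex.I * (((π * d * b / (2 * T ^ 2)) * (ω + π) : ℝ) : ℂ)) *
      dtlctKernel a b d T n (ω / 2 + π) = (-1) ^ n * dtlctKernel a b d T n (ω / 2) := by
  have hsign : ((-1 : ℂ)) ^ n = Complex.exp (-(n * (π * Complex.I))) := by
    rw [Complex.exp_neg, Complex.exp_int_mul, Complex.exp_pi_mul_I, ← inv_zpow, inv_neg_one]
  rw [hsign, dtlctKernel, dtlctKernel, ← Complex.exp_add, ← Complex.exp_add]
  congr 1
  push_cast
  ring

theorem dtlct_eq_finsum_mul_kernel (a b d T : ℝ) (x : ℤ → ℂ) (ω : ℝ) :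
    dtlct a b d T x ω = ∑ᶠ n : ℤ, x n * dtlctKernel a b d T n ω := rfl

/-- Downsampling-by-2 theorem for the DTLCT: if `y(n) = x(2n)` (sampling period `2T`),
then `Y(ω) = (1/2)·[X(ω/2) + exp(−i·(π·d·b/(2T²))·(ω+π))·X(ω/2 + π)]`. -/
theorem dtlct_downsample_two
    (a b c d T : ℝ) (hb : 0 < b) (habcd : a * d - b * c = 1) (hT : 0 < T)
    (x : ℤ → ℂ) (hx : (Function.support x).Finite)
    (y : ℤ → ℂ) (hy : ∀ n : ℤ, y n = x (2 * n)) :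
    ∀ ω : ℝ,
      dtlct a b d (2 * T) y ω =
        (1 / 2 : ℂ) *
          (dtlct a b d T x (ω / 2) +
            Complex.exp (-Complex.I * (((π * d * b / (2 * T ^ 2)) * (ω + π) : ℝ) : ℂ)) *
              dtlct a b d T x (ω / 2 + π)) := by
  intro ω
  have hsupp (g : ℤ → ℂ) : (Function.support fun n => x n * g n).Finite :=
    hx.subset (Function.support_mul_subset_left x g)
  simp only [dtlct_eq_finsum_mul_kernel]
  rw [mul_finsum]
  simp only [mul_left_comm _ (x _), exp_mul_dtlctKernel_add_pi]
  rw [← finsum_add_distrib (hsupp _) (hsupp _)]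
  symm
  refine (congrArg _ (finsum_int_eq_finsum_two_mul _ fun n => ?_)).trans ?_
  · rw [(odd_two_mul_add_one n).neg_one_zpow]
    ring
  · rw [mul_finsum]
    refine finsum_congr fun n => ?_
    rw [(even_two_mul n).neg_one_zpow, dtlctKernel_two_mul, hy]
    ring
end

section
/- LCT convolution theorem: let h, x : ℤ → ℂ be finitely supported with sampling period T and let y = h ∗ x be their LCT convolution. Then the DTLCTs satisfy Y(ω) = H(ω)·X(ω)·exp( −i·d·b·ω²/(2T²) ) for all ω ∈ ℝ. -/
open Real Complex

/-- LCT convolution at sampling period `T`. -/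
noncomputable def lctConv (a b T : ℝ) (h x : ℤ → ℂ) (n : ℤ) : ℂ :=
  ∑ᶠ k : ℤ, h k * x (n - k) *
    Complex.exp (-Complex.I * (((a * T ^ 2 / b) * (k : ℝ) * ((n : ℝ) - (k : ℝ)) : ℝ) : ℂ))

/-- A twisted convolution whose twist turns the weight `e` into a product is sent by the
`e`-weighted sum to a product of weighted sums. -/
theorem finsum_twisted_conv_mul {h x : ℤ → ℂ} (hh : (Function.support h).Finite)
    (hx : (Function.support x).Finite) (e : ℤ → ℂ) (w : ℤ → ℤ → ℂ) (C : ℂ)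
    (hw : ∀ k m, w k (k + m) * e (k + m) = e k * e m * C) :
    ∑ᶠ n, (∑ᶠ k, h k * x (n - k) * w k n) * e n =
      (∑ᶠ k, h k * e k) * (∑ᶠ m, x m * e m) * C := by
  have hconv : ∀ n, (∑ᶠ k, h k * x (n - k) * w k n) * e n =
      ∑ k ∈ hh.toFinset, h k * e k * C * (x (n - k) * e (n - k)) := by
    intro n
    rw [finsum_eq_sum_of_support_subset (s := hh.toFinset), Finset.sum_mul]
    · refine Finset.sum_congr rfl fun k _ => ?_
      have hk := hw k (n - k)
      rw [add_sub_cancel] at hk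
      linear_combination h k * x (n - k) * hk
    · intro k hk
      simp only [Set.Finite.coe_toFinset, Function.mem_support] at hk ⊢
      exact fun h0 => hk (by simp [h0])
  have hxe : (Function.support fun m => x m * e m).Finite :=
    hx.subset fun m hm => by
      simp only [Function.mem_support] at hm ⊢
      exact fun h0 => hm (by simp [h0])
  have hshift (k : ℤ) : (Function.support fun n => x (n - k) * e (n - k)).Finite :=
    hxe.preimage (sub_left_injective (b := k)).injOn
  rw [finsum_congr hconv, finsum_sum_comm]
  · have hsum (k : ℤ) : ∑ᶠ n, h k * e k * C * (x (n - k) * e (n - k)) =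
        h k * e k * C * ∑ᶠ m, x m * e m := by
      rw [← mul_finsum]
      exact congrArg _ (finsum_comp_equiv (Equiv.subRight k) (f := fun m => x m * e m))
    rw [finsum_eq_sum_of_support_subset (f := fun k => h k * e k) (s := hh.toFinset)]
    · simp only [hsum, Finset.sum_mul]
      exact Finset.sum_congr rfl fun k _ => by ring
    · intro k hk
      simp only [Set.Finite.coe_toFinset, Function.mem_support] at hk ⊢
      exact fun h0 => hk (by simp [h0])
  · intro k _
    refine (hshift k).subset fun n hn => ?_
    simp only [Function.mem_support] at hn ⊢
    exact fun h0 => hn (by rw [h0, mul_zero])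

/-- LCT convolution theorem: `Y(ω) = H(ω)·X(ω)·exp(−i·d·b·ω²/(2T²))`. -/
theorem dtlct_conv
    (a b c d T : ℝ) (hb : 0 < b) (habcd : a * d - b * c = 1) (hT : 0 < T)
    (h x : ℤ → ℂ) (hh : (Function.support h).Finite) (hx : (Function.support x).Finite)
    (y : ℤ → ℂ) (hy : ∀ n : ℤ, y n = lctConv a b T h x n) :
    ∀ ω : ℝ,
      dtlct a b d T y ω =
        dtlct a b d T h ω * dtlct a b d T x ω *
          Complex.exp (-Complex.I * ((d * b * ω ^ 2 / (2 * T ^ 2) : ℝ) : ℂ)) := by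
  intro ω
  simp only [dtlct, hy, lctConv]
  refine finsum_twisted_conv_mul hh hx _ _ _ fun k m => ?_
  simp only [← Complex.exp_add]
  congr 1
  push_cast
  ring
end

section
/- DTLCT of a delayed sequence: let x : ℤ → ℂ be finitely supported with sampling period T and let k ∈ ℤ. If y = D^k[x], then the DTLCTs satisfy Y(ω) = exp(−i·k·ω)·X(ω) for all ω ∈ ℝ. -/
open Real Complex

/-- LCT delay operator `D^k` at sampling period `T`. -/
noncomputable def lctDelay (a b T : ℝ) (k : ℤ) (x : ℤ → ℂ) (n : ℤ) : ℂ :=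
  x (n - k) * Complex.exp (Complex.I *
    (((a * T ^ 2 / (2 * b)) * (-2 * (n : ℝ) * (k : ℝ) + (k : ℝ) ^ 2) : ℝ) : ℂ))

/-- DTLCT of a delayed sequence: if `y = D^k[x]` then `Y(ω) = exp(−i·k·ω)·X(ω)`. -/
theorem dtlct_delay
    (a b c d T : ℝ) (hb : 0 < b) (habcd : a * d - b * c = 1) (hT : 0 < T)
    (x : ℤ → ℂ) (hx : (Function.support x).Finite)
    (k : ℤ) (y : ℤ → ℂ) (hy : ∀ n : ℤ, y n = lctDelay a b T k x n) :
    ∀ ω : ℝ,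
      dtlct a b d T y ω =
        Complex.exp (-Complex.I * (((k : ℝ) * ω : ℝ) : ℂ)) * dtlct a b d T x ω := by
  intro ω
  obtain rfl : y = lctDelay a b T k x := funext hy
  have hb' : (b : ℂ) ≠ 0 := mod_cast hb.ne'
  have hT' : (T : ℂ) ≠ 0 := mod_cast hT.ne'
  unfold dtlct
  rw [← smul_eq_mul (Complex.exp (-Complex.I * _)), smul_finsum, ← finsum_comp_equiv (Equiv.addRight k)]
  refine finsum_congr fun m => ?_
  simp only [lctDelay, Equiv.coe_addRight, add_sub_cancel_right, smul_eq_mul]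
  rw [mul_assoc, ← Complex.exp_add, mul_left_comm, ← Complex.exp_add]
  congr 2
  push_cast
  field_simp
  ring
end

section
/- Delay–convolution interchange: let h, x : ℤ → ℂ be finitely supported with sampling period T, let y = x ∗ h be their LCT convolution, and let k, l ∈ ℤ. Then D^l[x] ∗ D^k[h] = D^{l+k}[y], i.e. (D^l[x] ∗ D^k[h])(n) = D^{l+k}[x ∗ h](n) for all n ∈ ℤ. -/
open Real Complex

/-- Delay–convolution interchange: `D^l[x] ∗ D^k[h] = D^{l+k}[x ∗ h]`. -/
theorem lctConv_delay
    (a b c d T : ℝ) (hb : 0 < b) (habcd : a * d - b * c = 1) (hT : 0 < T)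
    (h x : ℤ → ℂ) (hh : (Function.support h).Finite) (hx : (Function.support x).Finite)
    (k l : ℤ) :
    ∀ n : ℤ,
      lctConv a b T (lctDelay a b T l x) (lctDelay a b T k h) n =
        lctDelay a b T (l + k) (lctConv a b T x h) n := by
  intro n
  unfold lctConv
  rw [← finsum_comp_equiv (Equiv.addRight l)]
  simp only [lctDelay, Equiv.coe_addRight]
  rw [finsum_mul' _ _ (hx.subset fun j hj => by
    simp only [Function.mem_support] at hj ⊢
    exact left_ne_zero_of_mul (left_ne_zero_of_mul hj))]
  refine finsum_congr fun j => ?_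
  rw [show j + l - l = j by ring, show n - (j + l) - k = n - (l + k) - j by ring]
  have regroup (u v e₁ e₂ e₃ : ℂ) :
      u * exp e₁ * (v * exp e₂) * exp e₃ = u * v * exp (e₁ + e₂ + e₃) := by
    rw [Complex.exp_add, Complex.exp_add]
    ring
  rw [regroup, mul_assoc _ (cexp _) (cexp _), ← Complex.exp_add]
  congr 2
  have hb' : (b : ℂ) ≠ 0 := by exact_mod_cast hb.ne'
  push_cast
  field_simp
  ring
end

section
/- Polyphase decomposition identity in the DTLCT domain: let x : ℤ → ℂ be finitely supported with sampling period T, with type-1 polyphase components x₀, x₁. Then X(ω) = X₀(2ω) + exp(i·ω)·X₁(2ω) for all ω ∈ ℝ, where X is the DTLCT of x with sampling period T and X₀, X₁ are the DTLCTs of x₀, x₁ with sampling period 2T. Likewise, if x₀, x₁ are the type-2 polyphase components of x, then X(ω) = X₀(2ω) + exp(−i·ω)·X₁(2ω) for all ω ∈ ℝ. -/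
open Real Complex

/-- Zeroth polyphase component (same for type 1 and type 2). -/
noncomputable def poly0 (x : ℤ → ℂ) (n : ℤ) : ℂ := x (2 * n)

/-- First type-1 polyphase component. -/
noncomputable def poly1T1 (a b T : ℝ) (x : ℤ → ℂ) (n : ℤ) : ℂ :=
  x (2 * n - 1) * Complex.exp (Complex.I *
    (((a * T ^ 2 / (2 * b)) * (1 - 4 * (n : ℝ)) : ℝ) : ℂ))

/-- First type-2 polyphase component. -/
noncomputable def poly1T2 (a b T : ℝ) (x : ℤ → ℂ) (n : ℤ) : ℂ :=
  x (2 * n + 1) * Complex.exp (Complex.I *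
    (((a * T ^ 2 / (2 * b)) * (4 * (n : ℝ) + 1) : ℝ) : ℂ))


/-- A finitely supported sum over `ℤ` splits into its even part and its odd part, the latter
being enumerated by `n ↦ 2 * n + k` for any odd `k`. -/
lemma finsum_int_even_add_odd {M : Type*} [AddCommMonoid M] {f : ℤ → M}
    (hf : (Function.support f).Finite) {k : ℤ} (hk : Odd k) :
    ∑ᶠ n, f n = ∑ᶠ n, f (2 * n) + ∑ᶠ n, f (2 * n + k) := by
  have he : Function.Injective fun n : ℤ => 2 * n := fun m n h => by simpa using h
  have ho : Function.Injective fun n : ℤ => 2 * n + k := fun m n h => by simpa using h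
  have hd : Disjoint (Set.range fun n : ℤ => 2 * n) (Set.range fun n : ℤ => 2 * n + k) := by
    obtain ⟨j, rfl⟩ := hk
    rw [Set.disjoint_left]
    rintro _ ⟨m, rfl⟩ ⟨n, hn⟩
    dsimp only at hn
    omega
  have hu : (Set.range fun n : ℤ => 2 * n) ∪ (Set.range fun n : ℤ => 2 * n + k) = Set.univ := by
    obtain ⟨j, rfl⟩ := hk
    refine Set.eq_univ_of_forall fun n => ?_
    rcases Int.even_or_odd' n with ⟨m, rfl | rfl⟩
    · exact Or.inl ⟨m, rfl⟩
    · exact Or.inr ⟨m - j, by dsimp only; ring⟩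
  rw [← finsum_mem_univ, ← hu, finsum_mem_union' hd (hf.subset Set.inter_subset_right)
    (hf.subset Set.inter_subset_right), finsum_mem_range he, finsum_mem_range ho]

/-- Polyphase decomposition identity in the DTLCT domain:
`X(ω) = X₀(2ω) + e^{iω} X₁(2ω)` for type-1 components, and
`X(ω) = X₀(2ω) + e^{−iω} X₁(2ω)` for type-2 components. -/
theorem dtlct_polyphase_decomp
    (a b c d T : ℝ) (hb : 0 < b) (habcd : a * d - b * c = 1) (hT : 0 < T)
    (x : ℤ → ℂ) (hx : (Function.support x).Finite) :
    ∀ ω : ℝ,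
      (dtlct a b d T x ω =
          dtlct a b d (2 * T) (poly0 x) (2 * ω) +
            Complex.exp (Complex.I * (ω : ℂ)) *
              dtlct a b d (2 * T) (poly1T1 a b T x) (2 * ω)) ∧
      (dtlct a b d T x ω =
          dtlct a b d (2 * T) (poly0 x) (2 * ω) +
            Complex.exp (-Complex.I * (ω : ℂ)) *
              dtlct a b d (2 * T) (poly1T2 a b T x) (2 * ω)) := by
  intro ω
  have hfin : (Function.support fun n : ℤ => x n * Complex.exp ((Complex.I / 2) *
      (((a / b) * (n : ℝ) ^ 2 * T ^ 2 - 2 * (n : ℝ) * ω +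
        (d * b / T ^ 2) * ω ^ 2 : ℝ) : ℂ))).Finite :=
    hx.subset (Function.support_mul_subset_left _ _)
  have hb' : (b : ℂ) ≠ 0 := by exact_mod_cast hb.ne'
  have hT' : (T : ℂ) ≠ 0 := by exact_mod_cast hT.ne'
  constructor
  · unfold dtlct poly0 poly1T1
    rw [finsum_int_even_add_odd hfin (k := -1) (by decide), mul_finsum]
    congr 1 <;> refine finsum_congr fun n => ?_
    · congr 2
      push_cast
      field_simp
    · rw [mul_left_comm, ← Complex.exp_add, mul_assoc (x _), ← Complex.exp_add,
        ← sub_eq_add_neg]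
      congr 2
      push_cast
      field_simp
      ring
  · unfold dtlct poly0 poly1T2
    rw [finsum_int_even_add_odd hfin (k := 1) (by decide), mul_finsum]
    congr 1 <;> refine finsum_congr fun n => ?_
    · congr 2
      push_cast
      field_simp
    · rw [mul_left_comm, ← Complex.exp_add, mul_assoc (x _), ← Complex.exp_add]
      congr 2
      push_cast
      field_simp
      ring
end

section
/- Modulation–polyphase relation: let x : ℤ → ℂ be finitely supported with sampling period T, with type-1 polyphase components x₀, x₁. Then for all ω ∈ ℝ, X(ω + π) = exp( i·(π·d·b/(2T²))·(2ω + π) )·( X₀(2ω) − exp(i·ω)·X₁(2ω) ), where X is the DTLCT of x with sampling period T and X₀, X₁ are the DTLCTs of x₀, x₁ with sampling period 2T. -/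
open Real Complex

/-- A finite sum over `ℤ` splits into its even-indexed and odd-indexed parts. -/
lemma finsum_int_eq_even_add_odd {M : Type*} [AddCommMonoid M] (f : ℤ → M)
    (hf : f.support.Finite) :
    ∑ᶠ n, f n = (∑ᶠ n, f (2 * n)) + ∑ᶠ n, f (2 * n - 1) := by
  have hunion : (Set.range fun n : ℤ => 2 * n) ∪ (Set.range fun n : ℤ => 2 * n - 1) =
      Set.univ := by
    ext n
    simp only [Set.mem_union, Set.mem_range, Set.mem_univ, iff_true]
    rcases Int.even_or_odd' n with ⟨k, hk | hk⟩
    · exact Or.inl ⟨k, hk.symm⟩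
    · exact Or.inr ⟨k + 1, by omega⟩
  have hdisj : Disjoint (Set.range fun n : ℤ => 2 * n) (Set.range fun n : ℤ => 2 * n - 1) := by
    rw [Set.disjoint_left]
    rintro _ ⟨k, rfl⟩ ⟨l, hl⟩
    simp only at hl
    omega
  rw [← finsum_mem_univ, ← hunion,
    finsum_mem_union' hdisj (hf.inter_of_right _) (hf.inter_of_right _),
    finsum_mem_range (fun k l h => by simpa using h),
    finsum_mem_range (fun k l h => by simpa using h)]

/-- Modulation–polyphase relation:
`X(ω + π) = exp(i·(π·d·b/(2T²))·(2ω + π))·(X₀(2ω) − e^{iω} X₁(2ω))`. -/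
theorem dtlct_modulation_polyphase
    (a b c d T : ℝ) (hb : 0 < b) (habcd : a * d - b * c = 1) (hT : 0 < T)
    (x : ℤ → ℂ) (hx : (Function.support x).Finite) :
    ∀ ω : ℝ,
      dtlct a b d T x (ω + π) =
        Complex.exp (Complex.I * (((π * d * b / (2 * T ^ 2)) * (2 * ω + π) : ℝ) : ℂ)) *
          (dtlct a b d (2 * T) (poly0 x) (2 * ω) -
            Complex.exp (Complex.I * (ω : ℂ)) *
              dtlct a b d (2 * T) (poly1T1 a b T x) (2 * ω)) := by
  intro ω
  have hbC : (b : ℂ) ≠ 0 := by exact_mod_cast hb.ne'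
  have hTC : (T : ℂ) ≠ 0 := by exact_mod_cast hT.ne'
  unfold dtlct
  rw [finsum_int_eq_even_add_odd _ (hx.subset (Function.support_mul_subset_left _ _)),
    mul_sub, sub_eq_add_neg, mul_finsum, ← mul_assoc, mul_finsum, ← finsum_neg_distrib]
  congr 1
  · refine finsum_congr fun n => ?_
    rw [poly0, mul_left_comm, ← Complex.exp_add]
    congr 1
    refine Complex.exp_eq_exp_iff_exists_int.mpr ⟨-n, ?_⟩
    push_cast
    field_simp
    ring
  · refine finsum_congr fun n => ?_
    rw [poly1T1, mul_assoc (x _), mul_left_comm, ← mul_neg, ← Complex.exp_add,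
      ← Complex.exp_add, ← Complex.exp_add, ← Complex.exp_add_pi_mul_I]
    congr 1
    refine Complex.exp_eq_exp_iff_exists_int.mpr ⟨-n, ?_⟩
    push_cast
    field_simp
    ring
end

section
/- Synthesis channel in polyphase form: let g : ℤ → ℂ (sampling period T) and y : ℤ → ℂ (sampling period 2T) be finitely supported, let v be the upsampling of y by 2 (v(2n) = y(n), v(m) = 0 for odd m, sampling period T), and let x̂ = g ∗ v. Let g₀, g₁ and x̂₀, x̂₁ be polyphase components of g and x̂ of the same type (both type-1 or both type-2). Then for all ω ∈ ℝ and for i = 0, 1: X̂ᵢ(ω) = exp( −i·d·b·ω²/(8T²) )·Gᵢ(ω)·Y(ω), where X̂₀, X̂₁, G₀, G₁, Y are DTLCTs with sampling period 2T. -/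
open Real Complex

/-- Upsampling by 2. -/
noncomputable def up2 (y : ℤ → ℂ) (m : ℤ) : ℂ := if 2 ∣ m then y (m / 2) else 0

/-- The total sum of a discrete convolution is the product of the total sums. -/
lemma finsum_finsum_mul_sub {A B : ℤ → ℂ} (hA : (Function.support A).Finite)
    (hB : (Function.support B).Finite) :
    ∑ᶠ n, ∑ᶠ m, A m * B (n - m) = (∑ᶠ m, A m) * ∑ᶠ j, B j := by
  have h_inner (n : ℤ) : ∑ᶠ m, A m * B (n - m) = ∑ m ∈ hA.toFinset, A m * B (n - m) := by
    apply finsum_eq_sum_of_support_subset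
    intro m hm
    simp only [Set.Finite.coe_toFinset]
    exact left_ne_zero_of_mul hm
  have h_shift (m : ℤ) : (Function.support fun n => B (n - m)).Finite :=
    hB.preimage (f := fun n : ℤ => n - m) (sub_left_injective.injOn)
  simp_rw [h_inner]
  rw [finsum_sum_comm, finsum_eq_sum A hA, Finset.sum_mul]
  · refine Finset.sum_congr rfl fun m _ => ?_
    rw [← mul_finsum]
    congr 1
    exact finsum_comp_equiv (Equiv.subRight m)
  · intro m _
    exact (h_shift m).subset fun n hn => right_ne_zero_of_mul hn

/-- Only indices of the same parity contribute to a convolution with an upsampled sequence. -/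
lemma lctConv_up2 (a b T : ℝ) (g y : ℤ → ℂ) (r n : ℤ) :
    lctConv a b T g (up2 y) (2 * n + r) = ∑ᶠ m : ℤ, g (2 * m + r) * y (n - m) *
      Complex.exp (-Complex.I *
        (((a * T ^ 2 / b) * (2 * m + r) * (2 * (n - m)) : ℝ) : ℂ)) := by
  have h_inj : Function.Injective fun m : ℤ => 2 * m + r := fun m m' h => by
    simp only at h
    omega
  set F : ℤ → ℂ := fun k => g k * up2 y (2 * n + r - k) * Complex.exp (-Complex.I *
    (((a * T ^ 2 / b) * (k : ℝ) * (((2 * n + r : ℤ) : ℝ) - (k : ℝ)) : ℝ) : ℂ)) with hF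
  have h_range : ∑ᶠ k, F k = ∑ᶠ m : ℤ, F (2 * m + r) := by
    rw [← finsum_mem_range (f := F) h_inj]
    refine finsum_congr fun k => ?_
    by_cases hk : k ∈ Set.range fun m : ℤ => 2 * m + r
    · simp [finsum_eq_if, hk]
    · have h_odd : ¬ (2 : ℤ) ∣ 2 * n + r - k := by
        rintro ⟨j, hj⟩
        exact hk ⟨n - j, by simp only; omega⟩
      simp [hk, hF, up2, h_odd]
  change ∑ᶠ k, F k = _
  rw [h_range]
  refine finsum_congr fun m => ?_
  have h_sub : 2 * n + r - (2 * m + r) = 2 * (n - m) := by ring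
  simp only [hF, up2, h_sub, dvd_mul_right, if_true]
  rw [Int.mul_ediv_cancel_left _ two_ne_zero]
  congr 4
  push_cast
  ring

/-- The transform identity for the polyphase component with offset `r`, modulated by the chirp
matching that offset. -/
lemma dtlct_lctConv_up2 {b T : ℝ} (a d : ℝ) (hb : b ≠ 0) (hT : T ≠ 0) {g y : ℤ → ℂ}
    (hg : (Function.support g).Finite) (hy : (Function.support y).Finite) (r : ℤ) (s ω : ℝ) :
    dtlct a b d (2 * T) (fun n => lctConv a b T g (up2 y) (2 * n + r) *
        Complex.exp (Complex.I * (((a * T ^ 2 / (2 * b)) * (4 * r * n + s) : ℝ) : ℂ))) ω =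
      Complex.exp (-Complex.I * ((d * b * ω ^ 2 / (8 * T ^ 2) : ℝ) : ℂ)) *
        dtlct a b d (2 * T) (fun n => g (2 * n + r) *
          Complex.exp (Complex.I * (((a * T ^ 2 / (2 * b)) * (4 * r * n + s) : ℝ) : ℂ))) ω *
        dtlct a b d (2 * T) y ω := by
  have h_inj : Function.Injective fun m : ℤ => 2 * m + r := fun m m' h => by
    simp only at h
    omega
  have h_g : (Function.support fun m => g (2 * m + r)).Finite :=
    hg.preimage (f := fun m : ℤ => 2 * m + r) h_inj.injOn
  unfold dtlct
  rw [mul_finsum _ (Complex.exp (-Complex.I * _)), ← finsum_finsum_mul_sub]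
  · refine finsum_congr fun n => ?_
    beta_reduce
    rw [lctConv_up2, finsum_mul, finsum_mul]
    refine finsum_congr fun m => ?_
    have h_exp : Complex.exp (-Complex.I *
          (((a * T ^ 2 / b) * (2 * m + r) * (2 * (n - m)) : ℝ) : ℂ)) *
        Complex.exp (Complex.I * (((a * T ^ 2 / (2 * b)) * (4 * r * n + s) : ℝ) : ℂ)) *
        Complex.exp ((Complex.I / 2) * (((a / b) * (n : ℝ) ^ 2 * (2 * T) ^ 2 -
          2 * (n : ℝ) * ω + (d * b / (2 * T) ^ 2) * ω ^ 2 : ℝ) : ℂ)) =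
        Complex.exp (-Complex.I * ((d * b * ω ^ 2 / (8 * T ^ 2) : ℝ) : ℂ)) *
        Complex.exp (Complex.I * (((a * T ^ 2 / (2 * b)) * (4 * r * m + s) : ℝ) : ℂ)) *
        Complex.exp ((Complex.I / 2) * (((a / b) * (m : ℝ) ^ 2 * (2 * T) ^ 2 -
          2 * (m : ℝ) * ω + (d * b / (2 * T) ^ 2) * ω ^ 2 : ℝ) : ℂ)) *
        Complex.exp ((Complex.I / 2) * (((a / b) * ((n - m : ℤ) : ℝ) ^ 2 * (2 * T) ^ 2 -
          2 * ((n - m : ℤ) : ℝ) * ω + (d * b / (2 * T) ^ 2) * ω ^ 2 : ℝ) : ℂ)) := by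
      have hb' : (b : ℂ) ≠ 0 := by exact_mod_cast hb
      have hT' : (T : ℂ) ≠ 0 := by exact_mod_cast hT
      simp only [← Complex.exp_add]
      congr 1
      push_cast
      field_simp
      ring
    linear_combination g (2 * m + r) * y (n - m) * h_exp
  · refine h_g.subset fun m hm => ?_
    simp only [Function.mem_support, ne_eq, mul_eq_zero, not_or] at hm ⊢
    exact hm.2.1.1
  · exact hy.subset fun j hj => left_ne_zero_of_mul hj

/-- Synthesis channel in polyphase form: if `x̂ = g ∗ up2(y)` then
`X̂ᵢ(ω) = exp(−i·d·b·ω²/(8T²))·Gᵢ(ω)·Y(ω)` for `i = 0, 1`, where the polyphase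
components of `g` and `x̂` are of the same type (both type-1 or both type-2). -/
theorem dtlct_synthesis_channel_polyphase
    (a b c d T : ℝ) (hb : 0 < b) (habcd : a * d - b * c = 1) (hT : 0 < T)
    (g y : ℤ → ℂ) (hg : (Function.support g).Finite) (hy : (Function.support y).Finite)
    (xhat : ℤ → ℂ) (hxhat : ∀ n : ℤ, xhat n = lctConv a b T g (up2 y) n) :
    ∀ ω : ℝ,
      (dtlct a b d (2 * T) (poly0 xhat) ω =
          Complex.exp (-Complex.I * ((d * b * ω ^ 2 / (8 * T ^ 2) : ℝ) : ℂ)) *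
            dtlct a b d (2 * T) (poly0 g) ω * dtlct a b d (2 * T) y ω) ∧
      (dtlct a b d (2 * T) (poly1T1 a b T xhat) ω =
          Complex.exp (-Complex.I * ((d * b * ω ^ 2 / (8 * T ^ 2) : ℝ) : ℂ)) *
            dtlct a b d (2 * T) (poly1T1 a b T g) ω * dtlct a b d (2 * T) y ω) ∧
      (dtlct a b d (2 * T) (poly1T2 a b T xhat) ω =
          Complex.exp (-Complex.I * ((d * b * ω ^ 2 / (8 * T ^ 2) : ℝ) : ℂ)) *
            dtlct a b d (2 * T) (poly1T2 a b T g) ω * dtlct a b d (2 * T) y ω) := by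
  intro ω
  obtain rfl : xhat = lctConv a b T g (up2 y) := funext hxhat
  have key := fun r s => dtlct_lctConv_up2 a d hb.ne' hT.ne' hg hy r s ω
  have h_poly0 (x : ℤ → ℂ) : poly0 x = fun n => x (2 * n + (0 : ℤ)) * Complex.exp
      (Complex.I * (((a * T ^ 2 / (2 * b)) * (4 * (0 : ℤ) * n + (0 : ℝ)) : ℝ) : ℂ)) := by
    ext n
    simp [poly0]
  have h_poly1T1 (x : ℤ → ℂ) : poly1T1 a b T x = fun n => x (2 * n + (-1 : ℤ)) * Complex.exp
      (Complex.I * (((a * T ^ 2 / (2 * b)) * (4 * (-1 : ℤ) * n + (1 : ℝ)) : ℝ) : ℂ)) := by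
    ext n
    rw [poly1T1, ← sub_eq_add_neg]
    congr 4
    push_cast
    ring
  have h_poly1T2 (x : ℤ → ℂ) : poly1T2 a b T x = fun n => x (2 * n + (1 : ℤ)) * Complex.exp
      (Complex.I * (((a * T ^ 2 / (2 * b)) * (4 * (1 : ℤ) * n + (1 : ℝ)) : ℝ) : ℂ)) := by
    ext n
    simp [poly1T2]
  rw [h_poly0, h_poly0, h_poly1T1, h_poly1T1, h_poly1T2, h_poly1T2]
  exact ⟨key 0 0, key (-1) 1, key 1 1⟩
end

section
/- Single-channel modulation relation: let h, g, x : ℤ → ℂ be finitely supported with sampling period T, and let x̂ = g ∗ up2( down2( h ∗ x ) ), where down2(u)(n) = u(2n) and up2(y)(2n) = y(n), up2(y)(m) = 0 for odd m (so x̂ again has sampling period T). Then for all ω ∈ ℝ, X̂(ω) = (1/2)·Σ_{m=0}^{1} exp( −i·d·b·(ω + mπ)²/T² )·G(ω)·H(ω + mπ)·X(ω + mπ), where X̂, G, H, X are DTLCTs with sampling period T. -/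
open Real Complex

/-- Downsampling by 2. -/
def down2 (u : ℤ → ℂ) (n : ℤ) : ℂ := u (2 * n)

/-- The sum of a convolution of finitely supported sequences is the product of their sums. -/
theorem finsum_conv_eq_mul_finsum {u v : ℤ → ℂ} (hu : (Function.support u).Finite)
    (hv : (Function.support v).Finite) :
    ∑ᶠ n : ℤ, ∑ᶠ k : ℤ, u k * v (n - k) = (∑ᶠ k : ℤ, u k) * ∑ᶠ n : ℤ, v n := by
  have inner_sum (n : ℤ) :
      ∑ᶠ k : ℤ, u k * v (n - k) = ∑ k ∈ hu.toFinset, u k * v (n - k) := by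
    refine finsum_eq_sum_of_support_subset _ fun k hk => ?_
    simpa using left_ne_zero_of_mul hk
  have shift_finite (k : ℤ) : (Function.support fun n : ℤ => u k * v (n - k)).Finite :=
    (hv.preimage (f := fun n : ℤ => n - k) (sub_left_injective.injOn)).subset
      fun n hn => right_ne_zero_of_mul hn
  simp_rw [inner_sum]
  rw [finsum_sum_comm _ _ fun k _ => shift_finite k, finsum_eq_sum u hu, Finset.sum_mul]
  refine Finset.sum_congr rfl fun k _ => ?_
  rw [← finsum_comp_equiv (Equiv.subRight k) (f := v), mul_finsum]
  rfl

theorem lctConv_support_finite (a b T : ℝ) {h x : ℤ → ℂ} (hh : (Function.support h).Finite)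
    (hx : (Function.support x).Finite) : (Function.support (lctConv a b T h x)).Finite := by
  refine (hh.add hx).subset fun n hn => ?_
  obtain ⟨k, hk⟩ := not_forall.mp (mt finsum_eq_zero_of_forall_eq_zero hn)
  have hk' := left_ne_zero_of_mul hk
  exact ⟨k, left_ne_zero_of_mul hk', n - k, right_ne_zero_of_mul hk', by simp⟩

theorem dtlct_lctConv (a b d T : ℝ) {h x : ℤ → ℂ} (hh : (Function.support h).Finite)
    (hx : (Function.support x).Finite) (ω : ℝ) :
    dtlct a b d T (lctConv a b T h x) ω =
      Complex.exp (-(Complex.I / 2) * ((d * b / T ^ 2 * ω ^ 2 : ℝ) : ℂ)) *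
        (dtlct a b d T h ω * dtlct a b d T x ω) := by
  unfold dtlct
  rw [← finsum_conv_eq_mul_finsum (hh.subset fun n hn => left_ne_zero_of_mul hn)
    (hx.subset fun n hn => left_ne_zero_of_mul hn), mul_finsum]
  refine finsum_congr fun n => ?_
  rw [lctConv, finsum_mul, mul_finsum]
  refine finsum_congr fun k => ?_
  have phase (p q r s t y z : ℂ) (e : p + q = r + (s + t)) :
      y * z * Complex.exp p * Complex.exp q =
        Complex.exp r * (y * Complex.exp s * (z * Complex.exp t)) := by
    have := congrArg Complex.exp e
    rw [Complex.exp_add, Complex.exp_add, Complex.exp_add] at this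
    linear_combination y * z * this
  apply phase
  push_cast
  ring

theorem up2_down2_apply (u : ℤ → ℂ) (n : ℤ) :
    up2 (down2 u) n = if 2 ∣ n then u n else 0 := by
  unfold up2 down2
  split_ifs with hn
  · rw [Int.mul_ediv_cancel' hn]
  · rfl

theorem up2_down2_support_finite {u : ℤ → ℂ} (hu : (Function.support u).Finite) :
    (Function.support (up2 (down2 u))).Finite := by
  refine hu.subset fun n hn => ?_
  rw [Function.mem_support, up2_down2_apply] at hn
  exact (ite_ne_right_iff.mp hn).2

theorem exp_neg_int_mul_pi_mul_I (n : ℤ) :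
    Complex.exp (-(n * π * Complex.I)) = if 2 ∣ n then 1 else -1 := by
  rw [Complex.exp_neg, mul_assoc, Complex.exp_int_mul, Complex.exp_pi_mul_I]
  split_ifs with hn
  · rw [(even_iff_two_dvd.mpr hn).neg_one_zpow, inv_one]
  · rw [(Int.not_even_iff_odd.mp (mt even_iff_two_dvd.mp hn)).neg_one_zpow]
    norm_num

/-- Discarding the odd samples averages the spectrum with its copy shifted by `π`. -/
theorem dtlct_up2_down2 (a b d T : ℝ) {u : ℤ → ℂ} (hu : (Function.support u).Finite) (ω : ℝ) :
    dtlct a b d T (up2 (down2 u)) ω =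
      1 / 2 * (dtlct a b d T u ω +
        Complex.exp (Complex.I / 2 * ((d * b / T ^ 2 * (ω ^ 2 - (ω + π) ^ 2) : ℝ) : ℂ)) *
          dtlct a b d T u (ω + π)) := by
  unfold dtlct
  rw [mul_finsum, ← finsum_add_distrib (hu.subset fun n hn => left_ne_zero_of_mul hn)
    (hu.subset fun n hn => left_ne_zero_of_mul (right_ne_zero_of_mul hn)), mul_finsum]
  refine finsum_congr fun n => ?_
  have shift (p q r s y : ℂ) (e : p + q = r + s) :
      Complex.exp p * (y * Complex.exp q) = Complex.exp r * (y * Complex.exp s) := by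
    have := congrArg Complex.exp e
    rw [Complex.exp_add, Complex.exp_add] at this
    linear_combination y * this
  rw [up2_down2_apply, shift _ _ (-(n * π * Complex.I)) (Complex.I / 2 *
    (((a / b) * (n : ℝ) ^ 2 * T ^ 2 - 2 * (n : ℝ) * ω + (d * b / T ^ 2) * ω ^ 2 : ℝ) : ℂ)) _
    (by push_cast; ring), exp_neg_int_mul_pi_mul_I]
  split_ifs <;> ring

/-- Single-channel modulation relation:
`X̂(ω) = (1/2)·Σ_{m=0}^{1} exp(−i·d·b·(ω+mπ)²/T²)·G(ω)·H(ω+mπ)·X(ω+mπ)`. -/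
theorem dtlct_channel_modulation
    (a b c d T : ℝ) (hb : 0 < b) (habcd : a * d - b * c = 1) (hT : 0 < T)
    (h g x : ℤ → ℂ) (hh : (Function.support h).Finite) (hg : (Function.support g).Finite)
    (hx : (Function.support x).Finite)
    (xhat : ℤ → ℂ)
    (hxhat : ∀ n : ℤ, xhat n = lctConv a b T g (up2 (down2 (lctConv a b T h x))) n) :
    ∀ ω : ℝ,
      dtlct a b d T xhat ω =
        (1 / 2 : ℂ) * ∑ m ∈ Finset.range 2,
          Complex.exp (-Complex.I * ((d * b * (ω + (m : ℝ) * π) ^ 2 / T ^ 2 : ℝ) : ℂ)) *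
            dtlct a b d T g ω * dtlct a b d T h (ω + (m : ℝ) * π) *
              dtlct a b d T x (ω + (m : ℝ) * π) := by
  intro ω
  have hu := lctConv_support_finite a b T hh hx
  rw [funext hxhat, dtlct_lctConv a b d T hg (up2_down2_support_finite hu),
    dtlct_up2_down2 a b d T hu, dtlct_lctConv a b d T hh hx, dtlct_lctConv a b d T hh hx]
  simp only [Finset.sum_range_succ, Finset.sum_range_zero, zero_add, Nat.cast_zero, zero_mul,
    add_zero, Nat.cast_one, one_mul]
  have phase₀ : Complex.exp (-Complex.I * ((d * b * ω ^ 2 / T ^ 2 : ℝ) : ℂ)) =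
      Complex.exp (-(Complex.I / 2) * ((d * b / T ^ 2 * ω ^ 2 : ℝ) : ℂ)) *
        Complex.exp (-(Complex.I / 2) * ((d * b / T ^ 2 * ω ^ 2 : ℝ) : ℂ)) := by
    rw [← Complex.exp_add]
    congr 1
    push_cast
    ring
  have phase₁ : Complex.exp (-Complex.I * ((d * b * (ω + π) ^ 2 / T ^ 2 : ℝ) : ℂ)) =
      Complex.exp (-(Complex.I / 2) * ((d * b / T ^ 2 * ω ^ 2 : ℝ) : ℂ)) *
        (Complex.exp (Complex.I / 2 * ((d * b / T ^ 2 * (ω ^ 2 - (ω + π) ^ 2) : ℝ) : ℂ)) *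
          Complex.exp (-(Complex.I / 2) * ((d * b / T ^ 2 * (ω + π) ^ 2 : ℝ) : ℂ))) := by
    rw [← Complex.exp_add, ← Complex.exp_add]
    congr 1
    push_cast
    ring
  rw [phase₀, phase₁]
  ring
end
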